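/- arXiv:1208.3819 — 2 statements merged into one kernel-verified Lean document; each statement's English description precedes it below -/
import Mathlib

section
/- Define the prime gap function λ(n) as the maximum of q − p over all primes p ≤ n, where q is the smallest prime exceeding p. There exist positive real constants c₁, c₂ such that: for every n ≥ 4, every Hadamard matrix H of order n, and every m×m submatrix M of H with m < n and |det(M)| = D(m), one has m < n/2 + c₁·λ(n)·ln(n) or m ≥ n − c₂·λ(n). -/
/-- A `{±1}`-matrix: every entry is `+1` or `-1`. -/
def IsPM1 {n : ℕ} (A : Matrix (Fin n) (Fin n) ℝ) : Prop :=
  ∀ i j, A i j = 1 ∨ A i j = -1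

/-- A Hadamard matrix of order `n`. -/
def IsHadamardMatrix {n : ℕ} (H : Matrix (Fin n) (Fin n) ℝ) : Prop :=
  IsPM1 H ∧ H * H.transpose = (n : ℝ) • (1 : Matrix (Fin n) (Fin n) ℝ)

/-- `maxDet k` is the maximal determinant `D(k)`: the maximum of `|det A|` over all
`{±1}`-matrices `A` of order `k`. -/
noncomputable def maxDet (k : ℕ) : ℝ :=
  sSup {x : ℝ | ∃ A : Matrix (Fin k) (Fin k) ℝ, IsPM1 A ∧ x = |A.det|}

/-- The prime gap function `λ(n)`: the maximum of `q - p` over all primes `p ≤ n`,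
where `q` is the smallest prime exceeding `p`. -/
noncomputable def primeGap (n : ℕ) : ℕ :=
  sSup {d : ℕ | ∃ p q : ℕ, p.Prime ∧ q.Prime ∧ p ≤ n ∧ p < q ∧
    (∀ r : ℕ, p < r → r < q → ¬ r.Prime) ∧ d = q - p}

lemma psd_det_le' {k : ℕ} (hk : 0 < k) (ev : Fin k → ℝ) (hnn : ∀ i, 0 ≤ ev i)
   (htr : ∑ i, ev i = (k : ℝ) * k) : ∏ i, ev i ≤ (k : ℝ) ^ k := by
  have hk' : (0 : ℝ) < k := by exact_mod_cast hk
  have am := Real.geom_mean_le_arith_mean Finset.univ (fun _ => (1:ℝ)) ev (by simp) (by simpa using hk) (by simpa using hnn)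
  simp [htr] at am
  have h0 : 0 ≤ ∏ i, ev i := Finset.prod_nonneg (fun i _ => hnn i)
  have := pow_le_pow_left₀ (by positivity) am k
  rwa [← Real.rpow_natCast, ← Real.rpow_mul h0, inv_mul_cancel₀ hk'.ne', Real.rpow_one] at this

lemma psd_det_le {k : ℕ} (A : Matrix (Fin k) (Fin k) ℝ) (hA : ∀ i j, A i j = 1 ∨ A i j = -1) :
    A.det ^ 2 ≤ (k : ℝ) ^ k := by
  rcases Nat.eq_zero_or_pos k with rfl | hk
  · simp
  have hP : (A * A.conjTranspose).PosSemidef := Matrix.posSemidef_self_mul_conjTranspose A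
  have h1 := hP.isHermitian.det_eq_prod_eigenvalues
  have h2 := hP.isHermitian.trace_eq_sum_eigenvalues
  have hnn := hP.eigenvalues_nonneg
  set ev := hP.isHermitian.eigenvalues
  have hdet : A.det ^ 2 = ∏ i, ev i := by
    rw [Matrix.det_mul, Matrix.det_conjTranspose] at h1
    simpa [sq] using h1
  have htr : ∑ i, ev i = (k : ℝ) * k := by
    have : (A * A.conjTranspose).trace = (k : ℝ) * k := by
      simp only [Matrix.trace, Matrix.diag, Matrix.mul_apply, Matrix.conjTranspose_apply, star_trivial]
      have : ∀ i j, A i j * A i j = 1 := by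
        intro i j; rcases hA i j with h | h <;> rw [h] <;> norm_num
      simp [this]
    rw [← this, h2]; simp
  rw [hdet]; exact psd_det_le' hk ev hnn htr

lemma compl_bound {n m : ℕ} (hmn : m < n) (H : Matrix (Fin n) (Fin n) ℝ)
    (hH1 : ∀ i j, H i j = 1 ∨ H i j = -1)
    (hH : H * H.transpose = (n : ℝ) • (1 : Matrix (Fin n) (Fin n) ℝ))
    (hdet : ∀ D : Matrix (Fin (n-m)) (Fin (n-m)) ℝ, (∀ i j, D i j = 1 ∨ D i j = -1) →
      D.det ^ 2 ≤ ((n - m : ℕ) : ℝ) ^ (n-m))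
    (f g : Fin m → Fin n) (hf : Function.Injective f) (hg : Function.Injective g) :
    (H.submatrix f g).det ^ 2 * (n:ℝ) ^ (n - m) ≤ (n : ℝ) ^ m * ((n - m : ℕ) : ℝ) ^ (n-m) := by
  have key : ∀ f : Fin m → Fin n, Function.Injective f →
      ∃ e : Fin m ⊕ Fin (n-m) ≃ Fin n, ∀ i, e (Sum.inl i) = f i := by
    intro f hf
    classical
    have hc : Fintype.card (Fin (n-m)) = Fintype.card ↑(Set.range f)ᶜ := by
      rw [Fintype.card_compl_set, Set.card_range_of_injective hf]; simp
    refine ⟨(Equiv.sumCongr (Equiv.ofInjective f hf) (Fintype.equivOfCardEq hc)).trans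
      (Equiv.Set.sumCompl (Set.range f)), fun i => by simp⟩
  obtain ⟨ef, hef⟩ := key f hf
  obtain ⟨eg, heg⟩ := key g hg
  set K := H.submatrix ef eg with hK
  have hKK : K * K.transpose = (n : ℝ) • 1 := by
    rw [hK, Matrix.transpose_submatrix, Matrix.submatrix_mul_equiv, hH]
    ext i j; simp [Matrix.one_apply]
  have hA : K.toBlocks₁₁ = H.submatrix f g := by
    ext i j; simp [K, Matrix.toBlocks₁₁, hef, heg]
  obtain ⟨A, B, C, D, hK2⟩ : ∃ A B C D, K = Matrix.fromBlocks A B C D := ⟨_, _, _, _, K.fromBlocks_toBlocks.symm⟩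
  have hD := hdet D (fun i j => by
    have : D i j = K (Sum.inr i) (Sum.inr j) := by rw [hK2]; rfl
    rw [this]; exact hH1 _ _)
  rw [← hA, hK2, Matrix.toBlocks_fromBlocks₁₁]
  have hd2 : K.det ^ 2 = (n:ℝ) ^ n := by
    have := congrArg Matrix.det hKK
    rw [Matrix.det_mul, Matrix.det_transpose, Matrix.det_smul] at this
    simp at this
    rw [sq, this]; congr 1; omega
  rw [hK2, Matrix.fromBlocks_transpose, Matrix.fromBlocks_multiply] at hKK
  rw [← Matrix.fromBlocks_one, Matrix.fromBlocks_smul, Matrix.fromBlocks_inj] at hKK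
  obtain ⟨e1, -, e3, -⟩ := hKK
  have hmul : K * Matrix.fromBlocks A.transpose 0 B.transpose 1 =
      Matrix.fromBlocks ((n:ℝ) • 1) B 0 D := by
    rw [hK2, Matrix.fromBlocks_multiply, e1, e3]; simp
  have h3 := congrArg Matrix.det hmul
  rw [Matrix.det_mul, Matrix.det_fromBlocks_zero₁₂, Matrix.det_fromBlocks_zero₂₁, Matrix.det_smul] at h3
  simp at h3
  have h4 : (n:ℝ)^n * A.det^2 = ((n:ℝ)^m)^2 * D.det^2 := by
    rw [← hd2, ← mul_pow, ← mul_pow, h3]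
  have hn : (0:ℝ) < n := by exact_mod_cast (by omega : 0 < n)
  have h5 : (n:ℝ)^n = (n:ℝ)^m * (n:ℝ)^(n-m) := by rw [← pow_add]; congr 1; omega
  have hp : (0:ℝ) < (n:ℝ)^m := by positivity
  have h6 : (n:ℝ)^m * (A.det^2 * (n:ℝ)^(n-m)) = (n:ℝ)^m * ((n:ℝ)^m * D.det^2) := by
    rw [h5] at h4; linarith
  rw [mul_left_cancel₀ hp.ne' h6]
  gcongr

open Matrix in
lemma col_step {m : ℕ} {ι : Type*} [DecidableEq ι] (R : Matrix (Fin m) ι ℝ)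
    (S : Finset ι) (G : Finset ι → Matrix (Fin m) (Fin m) ℝ)
    (hG : G = fun S => Matrix.of fun i k => ∑ j ∈ S, R i j * R k j)
    (h0 : 0 < (G S).det) :
    ∑ j ∈ S, (G (S.erase j)).det = ((S.card : ℝ) - m) * (G S).det := by
  have hu : IsUnit (G S).det := h0.ne'.isUnit
  have h1 : ∀ j ∈ S, (G (S.erase j)).det = (G S).det * (1 - ∑ i, ∑ k, R i j * (G S)⁻¹ i k * R k j) := by
    intro j hj
    have : G (S.erase j) = G S + replicateCol Unit (fun i => - R i j) * replicateRow Unit (fun i => R i j) := by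
      ext i k
      simp only [hG, Matrix.add_apply, Matrix.of_apply, Matrix.mul_apply, replicateCol_apply, replicateRow_apply]
      rw [← Finset.add_sum_erase S _ hj]; simp
    rw [this, det_add_replicateCol_mul_replicateRow hu]
    congr 1
    rw [Matrix.det_unique]
    simp only [Matrix.add_apply, Matrix.mul_apply, replicateCol_apply, replicateRow_apply, Matrix.one_apply_eq, Finset.sum_mul]
    rw [sub_eq_add_neg, ← Finset.sum_neg_distrib, Finset.sum_comm]
    congr 1
    refine Finset.sum_congr rfl fun i _ => ?_
    rw [← Finset.sum_neg_distrib]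
    refine Finset.sum_congr rfl fun k _ => ?_
    ring
  rw [Finset.sum_congr rfl h1, ← Finset.mul_sum, Finset.sum_sub_distrib]
  have : ∑ j ∈ S, ∑ i, ∑ k, R i j * (G S)⁻¹ i k * R k j = m := by
    have ht : ((G S)⁻¹ * G S).trace = m := by rw [Matrix.nonsing_inv_mul _ hu]; simp
    rw [← ht, Finset.sum_comm]
    simp only [Matrix.trace, Matrix.diag, Matrix.mul_apply]
    refine Finset.sum_congr rfl fun i _ => ?_
    rw [Finset.sum_comm]
    refine Finset.sum_congr rfl fun k _ => ?_
    conv_rhs => rw [hG]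
    simp only [Matrix.of_apply, Finset.mul_sum]
    refine Finset.sum_congr rfl fun j _ => ?_
    simp only [hG]
    ring
  rw [this]; simp; ring

lemma col_select {m h : ℕ} (hm : m ≤ h) (R : Matrix (Fin m) (Fin h) ℝ)
    (hR : R * R.transpose = (h : ℝ) • 1) (hh : 0 < h) :
    ∃ g : Fin m → Fin h, (h:ℝ)^m ≤ (R.submatrix id g).det ^ 2 * (h.choose m) := by
  set G : Finset (Fin h) → Matrix (Fin m) (Fin m) ℝ := 
    fun S => Matrix.of fun i k => ∑ j ∈ S, R i j * R k j with hG
  have hp : (0:ℝ) < (h:ℝ)^m := by positivity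
  have main : ∀ t : ℕ, t ≤ h - m → ∃ S : Finset (Fin h), S.card = h - t ∧
      (h:ℝ)^m * ((h-t).choose m) ≤ (G S).det * (h.choose m) := by
    intro t
    induction t with
    | zero =>
      intro _
      refine ⟨Finset.univ, by simp, ?_⟩
      have : G Finset.univ = (h:ℝ) • 1 := by
        rw [← hR]; ext i k; simp [hG, Matrix.mul_apply]
      rw [this, Matrix.det_smul]; simp
    | succ t ih =>
      intro ht
      obtain ⟨S, hS, hle⟩ := ih (by omega)
      obtain ⟨k, hk⟩ : ∃ k, h - t = k + 1 := ⟨h - t - 1, by omega⟩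
      have hk2 : h - (t+1) = k := by omega
      rw [hk2]; rw [hk] at hle hS
      have hmk : m ≤ k := by omega
      have hc : (0:ℝ) < h.choose m := by exact_mod_cast Nat.choose_pos hm
      have hc1 : (0:ℝ) < (k+1).choose m := by exact_mod_cast Nat.choose_pos (by omega)
      have hpos : 0 < (G S).det := by
        have : 0 < (G S).det * (h.choose m) := lt_of_lt_of_le (by positivity) hle
        exact pos_of_mul_pos_left this hc.le
      have hs := col_step R S G hG hpos
      have hne : S.Nonempty := by rw [← Finset.card_pos]; omega
      have hex : ∃ j ∈ S, ((S.card : ℝ) - m) * (G S).det / S.card ≤ (G (S.erase j)).det := by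
        apply Finset.exists_le_of_sum_le hne
        rw [hs, Finset.sum_const, nsmul_eq_mul, mul_div_cancel₀]
        exact_mod_cast (Finset.card_pos.2 hne).ne'
      obtain ⟨j, hj, hjle⟩ := hex
      refine ⟨S.erase j, by rw [Finset.card_erase_of_mem hj]; omega, ?_⟩
      rw [hS] at hjle
      have hb := Nat.choose_mul_succ_eq k m
      have hb' : ((k.choose m : ℕ):ℝ) * (k+1) = ((k+1).choose m : ℕ) * ((k:ℝ)+1 - m) := by
        have : ((k + 1 - m : ℕ) : ℝ) = (k:ℝ)+1-m := by rw [Nat.cast_sub (by omega)]; push_cast; ring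
        rw [← this]; exact_mod_cast hb
      rw [div_le_iff₀ (by positivity)] at hjle
      push_cast at hjle
      have hkp : (0:ℝ) < (k:ℝ)+1 := by positivity
      have hkm : (0:ℝ) ≤ (k:ℝ)+1-m := by
        have : (m:ℝ) ≤ k := by exact_mod_cast hmk
        linarith
      refine le_of_mul_le_mul_right ?_ hkp
      calc (h:ℝ)^m * (k.choose m) * (k+1) = ((h:ℝ)^m * ((k+1).choose m)) * ((k:ℝ)+1-m) := by
            rw [mul_assoc, hb']; ring
        _ ≤ ((G S).det * (h.choose m)) * ((k:ℝ)+1-m) := by gcongr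
        _ = (((k:ℝ)+1-m) * (G S).det) * (h.choose m) := by ring
        _ ≤ ((G (S.erase j)).det * (k+1)) * (h.choose m) := by gcongr
        _ = _ := by ring
  obtain ⟨S, hS, hle⟩ := main (h-m) le_rfl
  have hS' : S.card = m := by omega
  have : h - (h-m) = m := by omega
  rw [this] at hle
  let e := S.orderIsoOfFin hS'
  refine ⟨fun i => e i, ?_⟩
  have : G S = (R.submatrix id (fun i => (e i : Fin h))) * (R.submatrix id (fun i => (e i : Fin h))).transpose := by
    ext i k
    simp only [hG, Matrix.of_apply, Matrix.mul_apply, Matrix.submatrix_apply, Matrix.transpose_apply, id]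
    rw [← Finset.sum_coe_sort S]
    exact (Equiv.sum_comp e.toEquiv (fun j : S => R i j * R k j)).symm
  rw [this, Matrix.det_mul, Matrix.det_transpose] at hle
  simpa [sq] using hle

lemma chi_sum {p : ℕ} [Fact p.Prime] (hp : p ≠ 2) (c : ZMod p) (hc : c ≠ 0) :
    ∑ k : ZMod p, quadraticChar (ZMod p) k * quadraticChar (ZMod p) (k + c) = -1 := by
  have h0 : ∑ k : ZMod p, quadraticChar (ZMod p) k = 0 :=
    quadraticChar_sum_zero (by rwa [ZMod.ringChar_zmod_n])
  have h1 : ∀ k : ZMod p, quadraticChar (ZMod p) k * quadraticChar (ZMod p) (k + c) =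
      quadraticChar (ZMod p) (1 + c * k⁻¹) - if k = 0 then 1 else 0 := by
    intro k
    by_cases hk : k = 0
    · subst hk; simp
    · have : k + c = k * (1 + c * k⁻¹) := by field_simp
      rw [this, map_mul, ← mul_assoc, ← sq, quadraticChar_sq_one hk]; simp [hk]
  rw [Finset.sum_congr rfl (fun k _ => h1 k), Finset.sum_sub_distrib]
  have h2 : ∑ k : ZMod p, quadraticChar (ZMod p) (1 + c * k⁻¹) = 0 := by
    rw [← h0]
    exact Equiv.sum_comp (((Equiv.inv (ZMod p)).trans (Equiv.mulLeft₀ c hc)).trans (Equiv.addLeft 1))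
      (fun k => quadraticChar (ZMod p) k)
  rw [h2]; simp

lemma chi_sum2 {p : ℕ} [Fact p.Prime] (hp : p ≠ 2) (i j : ZMod p) :
    ∑ k : ZMod p, (quadraticChar (ZMod p) (i - k) : ℝ) * (quadraticChar (ZMod p) (j - k) : ℝ)
      = (if i = j then (p : ℝ) else 0) - 1 := by
  have : ∑ k : ZMod p, quadraticChar (ZMod p) (i - k) * quadraticChar (ZMod p) (j - k)
      = (if i = j then (p : ℤ) else 0) - 1 := by
    have e : ∑ k : ZMod p, quadraticChar (ZMod p) (i - k) * quadraticChar (ZMod p) (j - k) =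
       ∑ k : ZMod p, quadraticChar (ZMod p) k * quadraticChar (ZMod p) (k + (j - i)) := by
      rw [← Equiv.sum_comp (Equiv.subLeft i)]
      refine Finset.sum_congr rfl fun k _ => ?_
      simp
      left; congr 1; ring
    rw [e]
    by_cases h : i = j
    · subst h
      have : ∀ k : ZMod p, quadraticChar (ZMod p) k * quadraticChar (ZMod p) (k + (i - i)) =
        1 - if k = 0 then 1 else 0 := by
        intro k
        by_cases hk : k = 0
        · simp [hk]
        · simp only [sub_self, add_zero, ← sq, quadraticChar_sq_one hk]; simp [hk]
      rw [Finset.sum_congr rfl (fun k _ => this k)]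
      simp
    · rw [chi_sum hp _ (sub_ne_zero.2 (Ne.symm h))]; simp [h]
  have h2 := congrArg (Int.cast : ℤ → ℝ) this
  push_cast at h2
  exact h2

lemma chi_sum3 {p : ℕ} [Fact p.Prime] (hp : p ≠ 2) (i : ZMod p) :
    ∑ k : ZMod p, (quadraticChar (ZMod p) (i - k) : ℝ) = 0 := by
  have h0 : ∑ k : ZMod p, quadraticChar (ZMod p) k = 0 :=
    quadraticChar_sum_zero (by rwa [ZMod.ringChar_zmod_n])
  rw [← Equiv.sum_comp (Equiv.subLeft i)] at h0
  exact_mod_cast h0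

lemma conf_exists {p : ℕ} [Fact p.Prime] (hp : p ≠ 2) :
    ∃ C : Matrix (Option (ZMod p)) (Option (ZMod p)) ℝ,
      (∀ i, C i i = 0) ∧ (∀ i j, i ≠ j → C i j = 1 ∨ C i j = -1) ∧
      C * C.transpose = (p:ℝ) • 1 := by
  refine ⟨Matrix.of fun i j => match i, j with
    | none, none => 0
    | none, some _ => 1
    | some _, none => 1
    | some i, some j => (quadraticChar (ZMod p) (i - j) : ℝ), ?_, ?_, ?_⟩
  · rintro (_ | i) <;> simp
  · rintro (_ | i) (_ | j) hij
    · exact absurd rfl hij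
    · simp
    · simp
    simp only [Matrix.of_apply]
    have : i - j ≠ 0 := by
      intro h; exact hij (by rw [sub_eq_zero.1 h])
    rcases quadraticChar_dichotomy this with h | h <;> rw [h] <;> simp
  · ext i j
    rw [Matrix.mul_apply, Fintype.sum_option]
    rcases i with _ | i <;> rcases j with _ | j
    · simp
    · simp [chi_sum3 hp, -quadraticChar_apply]
    · simp [chi_sum3 hp, -quadraticChar_apply]
    · simp [chi_sum2 hp, -quadraticChar_apply, Matrix.one_apply]

open Matrix in
lemma had_exists {p : ℕ} (hpp : p.Prime) (hp : p ≠ 2) :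
    ∃ H : Matrix (Fin (2*(p+1))) (Fin (2*(p+1))) ℝ, (∀ i j, H i j = 1 ∨ H i j = -1) ∧
      H * H.transpose = ((2*(p+1) : ℕ):ℝ) • 1 := by
  have : Fact p.Prime := ⟨hpp⟩
  obtain ⟨C, h0, h1, hC⟩ := conf_exists hp
  have hp0 : (p:ℝ) ≠ 0 := by exact_mod_cast hpp.ne_zero
  have hC' : Cᵀ * C = (p:ℝ) • 1 := by
    have : C * ((p:ℝ)⁻¹ • Cᵀ) = 1 := by
      rw [Matrix.mul_smul, hC, smul_smul, inv_mul_cancel₀ hp0, one_smul]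
    have h2 := mul_eq_one_comm.1 this
    rw [Matrix.smul_mul] at h2
    rw [← h2, smul_smul, mul_inv_cancel₀ hp0, one_smul]
  set K := Matrix.fromBlocks (C + 1) (C - 1) (-(C - 1)ᵀ) (C + 1)ᵀ with hK
  have hKK : K * Kᵀ = ((2*(p+1) : ℕ):ℝ) • 1 := by
    rw [hK, Matrix.fromBlocks_transpose, Matrix.fromBlocks_multiply, ← Matrix.fromBlocks_one, Matrix.fromBlocks_smul]
    have e : ((2*(p+1) : ℕ):ℝ) • (1 : Matrix (Option (ZMod p)) (Option (ZMod p)) ℝ) = (p:ℝ) • 1 + (p:ℝ) • 1 + 1 + 1 := by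
      push_cast
      rw [show (2*((p:ℝ)+1)) = p + p + 1 + 1 by ring]
      simp only [add_smul, one_smul]
    rw [e]
    simp only [transpose_neg, transpose_transpose, transpose_add, transpose_sub, transpose_one, smul_zero]
    congr 1
    · simp only [add_mul, mul_add, sub_mul, mul_sub, hC, one_mul, mul_one]; abel
    · simp only [add_mul, mul_add, sub_mul, mul_sub, one_mul, mul_one, mul_neg]; abel
    · simp only [add_mul, mul_add, sub_mul, mul_sub, one_mul, mul_one, neg_mul]; abel
    · simp only [add_mul, mul_add, sub_mul, mul_sub, hC', one_mul, mul_one, mul_neg, neg_mul]; abel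
  have hcp : ∀ i j, (C + 1) i j = 1 ∨ (C + 1) i j = -1 := by
    intro i j
    by_cases h : i = j
    · subst h; simp [h0]
    · simpa [h, Matrix.one_apply] using h1 i j h
  have hcm : ∀ i j, (C - 1) i j = 1 ∨ (C - 1) i j = -1 := by
    intro i j
    by_cases h : i = j
    · subst h; simp [h0]
    · simpa [h, Matrix.one_apply] using h1 i j h
  have hKe : ∀ i j, K i j = 1 ∨ K i j = -1 := by
    rintro (i | i) (j | j)
    · exact hcp i j
    · exact hcm i j
    · have := hcm j i
      simp only [hK, Matrix.fromBlocks_apply₂₁, Matrix.neg_apply, Matrix.transpose_apply]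
      rcases this with h | h <;> rw [h] <;> simp
    · exact hcp j i
  have hcard : Fintype.card (Fin (2*(p+1))) = Fintype.card (Option (ZMod p) ⊕ Option (ZMod p)) := by
    simp [ZMod.card]; ring
  let e := Fintype.equivOfCardEq hcard
  refine ⟨K.submatrix e e, fun i j => hKe _ _, ?_⟩
  rw [Matrix.transpose_submatrix, Matrix.submatrix_mul_equiv, hKK]
  ext i j; simp [Matrix.one_apply]

lemma gap_prime {n a : ℕ} (h2 : 2 ≤ a) (han : a ≤ n) :
    ∃ q, q.Prime ∧ a < q ∧ q ≤ a + primeGap n := by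
  classical
  have hex : ∃ q, q.Prime ∧ a < q := by
    obtain ⟨r, hr, hrp⟩ := Nat.exists_infinite_primes (a+1)
    exact ⟨r, hrp, hr⟩
  obtain ⟨hq, haq⟩ := Nat.find_spec hex
  have hmin : ∀ r, r < Nat.find hex → ¬ (r.Prime ∧ a < r) := fun r h => Nat.find_min hex h
  set q := Nat.find hex
  set p := Nat.findGreatest Nat.Prime a with hp
  have hpp : p.Prime := Nat.findGreatest_spec h2 Nat.prime_two
  have hpa : p ≤ a := Nat.findGreatest_le a
  have hmem : q - p ∈ {d : ℕ | ∃ p q : ℕ, p.Prime ∧ q.Prime ∧ p ≤ n ∧ p < q ∧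
    (∀ r : ℕ, p < r → r < q → ¬ r.Prime) ∧ d = q - p} := by
    refine ⟨p, q, hpp, hq, hpa.trans han, by omega, ?_, rfl⟩
    intro r h1 h3 hr
    by_cases har : a < r
    · exact hmin r h3 ⟨hr, har⟩
    · exact Nat.findGreatest_is_greatest h1 (by omega) hr
  have hb : BddAbove {d : ℕ | ∃ p q : ℕ, p.Prime ∧ q.Prime ∧ p ≤ n ∧ p < q ∧
    (∀ r : ℕ, p < r → r < q → ¬ r.Prime) ∧ d = q - p} := by
    obtain ⟨r, hr, hrp⟩ := Nat.exists_infinite_primes (n+1)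
    refine ⟨r, ?_⟩
    rintro d ⟨p, q, -, -, hpn, -, hno, rfl⟩
    by_contra hlt
    exact hno r (by omega) (by omega) hrp
  have := le_csSup hb hmem
  refine ⟨q, hq, haq, ?_⟩
  change q - p ≤ primeGap n at this
  omega


lemma analysis {m d δ n : ℝ} (hm : 0 < m) (hd : 0 < d) (hδ : 1 ≤ δ) (hn : n = m + d)
    (hdm : d < m) (h16 : 16 * δ ≤ d)
    (hlog : m * Real.log m + δ * Real.log δ + d * Real.log n ≤
      m * Real.log n + d * Real.log d + δ * Real.log n) :
    m - n / 2 ≤ 10 * δ * Real.log n := by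
  have hn0 : 0 < n := by linarith
  have hδ0 : 0 < δ := by linarith
  have l2 := Real.log_two_gt_d9
  have l2' := Real.log_two_lt_d9
  have hlδ : 0 ≤ Real.log δ := Real.log_nonneg hδ
  by_cases h4 : 4 * d ≤ n
  · exfalso
    have a1 : m * (Real.log n - Real.log m) ≤ d := by
      rw [← Real.log_div hn0.ne' hm.ne']
      have := Real.log_le_sub_one_of_pos (div_pos hn0 hm)
      calc m * Real.log (n/m) ≤ m * (n/m - 1) := by gcongr
        _ = d := by field_simp; linarith
    have a2 : 2 * Real.log 2 ≤ Real.log n - Real.log d := by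
      have : Real.log (4 * d) ≤ Real.log n := Real.log_le_log (by positivity) h4
      rw [Real.log_mul (by norm_num) hd.ne', show (4:ℝ) = 2^2 by norm_num, Real.log_pow] at this
      push_cast at this; linarith
    have a3 : δ * (Real.log d - Real.log δ - 4 * Real.log 2) ≤ d / 16 - δ := by
      have e : Real.log d - Real.log δ - 4 * Real.log 2 = Real.log (d / (16 * δ)) := by
        rw [Real.log_div hd.ne' (by positivity), Real.log_mul (by norm_num) hδ0.ne',
          show (16:ℝ) = 2^4 by norm_num, Real.log_pow]
        push_cast; ring
      rw [e]
      have := Real.log_le_sub_one_of_pos (show 0 < d / (16 * δ) by positivity)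
      calc δ * Real.log (d / (16 * δ)) ≤ δ * (d / (16 * δ) - 1) := by gcongr
        _ = d / 16 - δ := by field_simp
    have a4 : δ * (4 * Real.log 2 - 1) ≤ d / 16 * (4 * Real.log 2 - 1) := by
      apply mul_le_mul_of_nonneg_right <;> linarith
    have a5 : δ * (Real.log n - Real.log d) ≤ d / 16 * (Real.log n - Real.log d) := by
      apply mul_le_mul_of_nonneg_right <;> linarith
    have a6 : d * (15/16 * (Real.log n - Real.log d) - 1 - Real.log 2 / 4) ≤ 0 := by linarith
    have a7 : 0 < d * (15/16 * (Real.log n - Real.log d) - 1 - Real.log 2 / 4) := by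
      apply mul_pos hd; linarith
    linarith
  · push Not at h4
    have b1 : m * (Real.log n - Real.log m - Real.log 2) ≤ n / 2 - m := by
      have e : Real.log n - Real.log m - Real.log 2 = Real.log (n / (2 * m)) := by
        rw [Real.log_div hn0.ne' (by positivity), Real.log_mul (by norm_num) hm.ne']; ring
      rw [e]
      have := Real.log_le_sub_one_of_pos (show 0 < n / (2 * m) by positivity)
      calc m * Real.log (n / (2 * m)) ≤ m * (n / (2 * m) - 1) := by gcongr
        _ = _ := by field_simp
    have b2 : (m - d) / 4 ≤ d * (Real.log n - Real.log d - Real.log 2) := by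
      have e : Real.log n - Real.log d - Real.log 2 = - Real.log (2 * d / n) := by
        rw [Real.log_div (by positivity) hn0.ne', Real.log_mul (by norm_num) hd.ne']; ring
      rw [e]
      have := Real.log_le_sub_one_of_pos (show 0 < 2 * d / n by positivity)
      have e2 : 2 * d / n - 1 = - ((m - d) / n) := by rw [hn]; field_simp; ring
      have h3 : (m - d) / n ≤ - Real.log (2 * d / n) := by linarith
      calc (m - d) / 4 = (n / 4) * ((m - d) / n) := by field_simp
        _ ≤ d * ((m-d)/n) := by
          apply mul_le_mul_of_nonneg_right (by linarith)
          apply div_nonneg <;> linarith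
        _ ≤ _ := by gcongr
    have b3 : 0 ≤ δ * Real.log δ := by positivity
    have b4 : (m - d) * (1/20) ≤ (m - d) * (3/4 - Real.log 2) := by
      apply mul_le_mul_of_nonneg_left <;> linarith
    subst hn
    nlinarith

lemma choose_bound (m δ : ℕ) : (((m+δ).choose m : ℕ):ℝ) * (m:ℝ)^m * (δ:ℝ)^δ ≤ ((m+δ : ℕ):ℝ)^(m+δ) := by
  have h := add_pow (m:ℝ) (δ:ℝ) (m+δ)
  push_cast
  rw [h]
  have := Finset.single_le_sum (f := fun k => (m:ℝ)^k * (δ:ℝ)^(m+δ-k) * ((m+δ).choose k : ℕ)) (s := Finset.range (m+δ+1))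
    (fun i _ => by positivity) (Finset.mem_range.2 (by omega : m < m+δ+1))
  simp only [Nat.add_sub_cancel_left] at this
  linarith

lemma combine {m d δ : ℕ} (hm : 0 < m) (hd : 0 < d) (hδ : 0 < δ) (hδd : δ ≤ d) {X : ℝ}
    (h1 : ((m+δ : ℕ):ℝ)^m ≤ X * ((m+δ).choose m : ℕ))
    (h2 : X * ((m+d : ℕ):ℝ)^d ≤ ((m+d : ℕ):ℝ)^m * (d:ℝ)^d) :
    m * Real.log m + δ * Real.log δ + d * Real.log (m+d : ℕ) ≤
      m * Real.log (m+d : ℕ) + d * Real.log d + δ * Real.log (m+d : ℕ) := by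
  have h3 := choose_bound m δ
  have hm' : (0:ℝ) < m := by exact_mod_cast hm
  have hd' : (0:ℝ) < d := by exact_mod_cast hd
  have hδ' : (0:ℝ) < δ := by exact_mod_cast hδ
  have hh : ((m+δ : ℕ):ℝ) ≤ ((m+d : ℕ):ℝ) := by exact_mod_cast (by omega)
  have hh0 : (0:ℝ) < ((m+δ : ℕ):ℝ) := by exact_mod_cast (by omega)
  have hn0 : (0:ℝ) < ((m+d : ℕ):ℝ) := by exact_mod_cast (by omega)
  set h : ℝ := ((m+δ : ℕ):ℝ)
  set n : ℝ := ((m+d : ℕ):ℝ)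
  set c : ℝ := (((m+δ).choose m : ℕ):ℝ)
  have h4 : h^m * ((m:ℝ)^m * (δ:ℝ)^δ * n^d) ≤ h^m * (n^m * (d:ℝ)^d * n^δ) := by
    calc h^m * ((m:ℝ)^m * (δ:ℝ)^δ * n^d) ≤ (X * c) * ((m:ℝ)^m * (δ:ℝ)^δ * n^d) := by gcongr
      _ = (X * n^d) * (c * (m:ℝ)^m * (δ:ℝ)^δ) := by ring
      _ ≤ (n^m * (d:ℝ)^d) * (c * (m:ℝ)^m * (δ:ℝ)^δ) := by gcongr
      _ ≤ (n^m * (d:ℝ)^d) * h^(m+δ) := by gcongr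
      _ = h^m * (n^m * (d:ℝ)^d * h^δ) := by rw [pow_add]; ring
      _ ≤ _ := by gcongr
  have h5 := le_of_mul_le_mul_left h4 (by positivity)
  have h6 := Real.log_le_log (by positivity) h5
  rw [Real.log_mul (by positivity) (by positivity), Real.log_mul (by positivity) (by positivity),
    Real.log_mul (by positivity) (by positivity), Real.log_mul (by positivity) (by positivity)] at h6
  simpa only [Real.log_pow] using h6

lemma le_maxDet {k : ℕ} (A : Matrix (Fin k) (Fin k) ℝ) (hA : IsPM1 A) : |A.det| ≤ maxDet k := by
  refine le_csSup ⟨(k:ℝ)^k + 1, ?_⟩ ⟨A, hA, rfl⟩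
  rintro x ⟨B, hB, rfl⟩
  have := psd_det_le B hB
  rw [← sq_abs] at this
  nlinarith [sq_nonneg (|B.det| - 1)]

/-- Unconditional excluded interval for orders of maxdet submatrices of
Hadamard matrices. -/
theorem excluded_interval_unconditional :
    ∃ c₁ c₂ : ℝ, 0 < c₁ ∧ 0 < c₂ ∧
      ∀ (n : ℕ), 4 ≤ n →
        ∀ H : Matrix (Fin n) (Fin n) ℝ, IsHadamardMatrix H →
          ∀ (m : ℕ) (f g : Fin m → Fin n), m < n →
            Function.Injective f → Function.Injective g →
            |(H.submatrix f g).det| = maxDet m →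
            ((m : ℝ) < (n : ℝ) / 2 + c₁ * (primeGap n : ℝ) * Real.log n ∨
              (n : ℝ) - c₂ * (primeGap n : ℝ) ≤ (m : ℝ)) := by
  refine ⟨61, 96, by norm_num, by norm_num, ?_⟩
  intro n hn H hH m f g hmn hf hg hmax
  have hlogn : 0 < Real.log n := Real.log_pos (by exact_mod_cast (by omega : 1 < n))
  have hlam : 1 ≤ primeGap n := by
    obtain ⟨q, -, h1, h2⟩ := gap_prime (n := n) (a := 2) le_rfl (by omega)
    omega
  have hlam' : (1:ℝ) ≤ primeGap n := by exact_mod_cast hlam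
  have hpos : 0 < (primeGap n : ℝ) * Real.log n := by positivity
  obtain ⟨d, rfl⟩ : ∃ d, n = m + d := ⟨n - m, by omega⟩
  have hd : 0 < d := by omega
  by_cases hdm : d < m
  swap
  · left
    have : (m:ℝ) ≤ d := by exact_mod_cast (by omega : m ≤ d)
    push_cast at hpos ⊢
    linarith
  obtain ⟨q, hq, hq1, hq2⟩ := gap_prime (n := m + d) (a := m / 2 + 1) (by omega) (by omega)
  obtain ⟨δ, hδ⟩ : ∃ δ, 2 * (q + 1) = m + δ := ⟨2 * (q+1) - m, by omega⟩
  have hδ1 : 1 ≤ δ := by omega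
  have hδ2 : δ ≤ 6 * primeGap (m + d) := by omega
  have hδ2' : (δ:ℝ) ≤ 6 * (primeGap (m + d) : ℝ) := by exact_mod_cast hδ2
  by_cases h16 : 16 * δ ≤ d
  swap
  · right
    have : (d:ℝ) ≤ 16 * δ := by exact_mod_cast (by omega : d ≤ 16 * δ)
    push_cast
    linarith
  left
  have hex := had_exists hq (by omega)
  rw [hδ] at hex
  obtain ⟨K, hK1, hK2⟩ := hex
  have hR : (K.submatrix (Fin.castAdd δ) id) * (K.submatrix (Fin.castAdd δ) id).transpose =
      ((m + δ : ℕ) : ℝ) • (1 : Matrix (Fin m) (Fin m) ℝ) := by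
    ext i j
    have := congrFun (congrFun hK2 (Fin.castAdd δ i)) (Fin.castAdd δ j)
    simpa [Matrix.mul_apply, Matrix.one_apply] using this
  obtain ⟨e, he⟩ := col_select (by omega) _ hR (by omega)
  have hle := le_maxDet ((K.submatrix (Fin.castAdd δ) id).submatrix id e) (fun i j => hK1 _ _)
  rw [← hmax] at hle
  have hsq := sq_le_sq' (by
    have q1 := abs_nonneg (H.submatrix f g).det
    have q2 := abs_nonneg ((K.submatrix (Fin.castAdd δ) id).submatrix id e).det
    linarith) hle
  rw [sq_abs, sq_abs] at hsq
  have h1 : ((m+δ : ℕ):ℝ)^m ≤ (H.submatrix f g).det ^ 2 * ((m+δ).choose m : ℕ) :=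
    he.trans (by gcongr)
  have h2 := compl_bound hmn H hH.1 hH.2 (fun D hD => psd_det_le D hD) f g hf hg
  rw [Nat.add_sub_cancel_left] at h2
  have h3 := combine (by omega) hd (by omega) (by omega) h1 h2
  have h4 := analysis (m := m) (d := d) (δ := δ) (n := ((m + d : ℕ) : ℝ))
    (by exact_mod_cast (by omega : 0 < m)) (by exact_mod_cast hd) (by exact_mod_cast hδ1)
    (by push_cast; ring) (by exact_mod_cast hdm) (by exact_mod_cast h16) h3
  have h5 : (δ:ℝ) * Real.log (m + d : ℕ) ≤ 6 * (primeGap (m + d) : ℝ) * Real.log (m + d : ℕ) := by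
    gcongr
  linarith
end

section
/- Let A be any {±1}-matrix of order n ≥ 2. Then the number Z(2,A) of vanishing minors of order 2 of A satisfies Z(2,A) ≥ n²(n−1)(n−2)/8. -/
/-- `Z m A` is the number of pairs `(R, C)` of `m`-element subsets of the row and
column indices of `A` such that the `m × m` submatrix of `A` on rows `R` and
columns `C` has vanishing determinant. -/
noncomputable def Z {n : ℕ} (m : ℕ) (A : Matrix (Fin n) (Fin n) ℝ) : ℕ :=
  Nat.card {p : Finset (Fin n) × Finset (Fin n) //
    ∃ (h₁ : p.1.card = m) (h₂ : p.2.card = m),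
      (A.submatrix (fun i => (p.1.orderIsoOfFin h₁ i : Fin n))
        (fun j => (p.2.orderIsoOfFin h₂ j : Fin n))).det = 0}

lemma sym_sum_aux {n : ℕ} (f : Fin n → Fin n → ℝ) (hf : ∀ i j, f i j = f j i) :
    ∑ i, ∑ j, f i j = ∑ i, f i i + 2 * ∑ i, ∑ j, (if i < j then f i j else 0) := by
  have h1 : ∀ i j, f i j = (if i = j then f i j else 0) +
      ((if i < j then f i j else 0) + (if j < i then f j i else 0)) := by
    intro i j
    rcases lt_trichotomy i j with h | h | h
    · simp [h, h.ne, h.not_gt]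
    · simp [h]
    · simp [h, h.ne', h.not_gt, hf i j]
  have h2 : ∑ i, ∑ j, (if j < i then f j i else 0)
      = ∑ i, ∑ j, (if i < j then f i j else 0) := Finset.sum_comm
  calc ∑ i, ∑ j, f i j = ∑ i, ∑ j, ((if i = j then f i j else 0) +
      ((if i < j then f i j else 0) + (if j < i then f j i else 0))) :=
        Finset.sum_congr rfl fun i _ => Finset.sum_congr rfl fun j _ => h1 i j
    _ = _ := by
      simp only [Finset.sum_add_distrib, h2, Finset.sum_ite_eq, Finset.mem_univ, if_true]
      ring

lemma row_pair_aux {n : ℕ} (A : Matrix (Fin n) (Fin n) ℝ) (hA : IsPM1 A) (i i' : Fin n) :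
    (n : ℝ) * ((n : ℝ) - 2) / 2 ≤
      ∑ j, ∑ j', (if j < j' then 1 + A i j * A i' j * (A i j' * A i' j') else 0) := by
  have h := sym_sum_aux (fun j j' => 1 + A i j * A i' j * (A i j' * A i' j'))
    (fun j j' => by ring)
  have hd : ∀ j, 1 + A i j * A i' j * (A i j * A i' j) = 2 := by
    intro j
    rcases hA i j with h | h <;> rcases hA i' j with h' | h' <;> rw [h, h'] <;> norm_num
  simp only [hd, Finset.sum_add_distrib, ← Finset.mul_sum, ← Finset.sum_mul] at h
  simp at h
  nlinarith [mul_self_nonneg (∑ j, A i j * A i' j)]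

open Classical in
noncomputable def goodQuad {n : ℕ} (A : Matrix (Fin n) (Fin n) ℝ) :
    Finset ((Fin n × Fin n) × (Fin n × Fin n)) :=
  Finset.univ.filter fun q => q.1.1 < q.1.2 ∧ q.2.1 < q.2.2 ∧
    A q.1.1 q.2.1 * A q.1.2 q.2.2 = A q.1.1 q.2.2 * A q.1.2 q.2.1

lemma pair_inj_aux {n : ℕ} {a b c d : Fin n} (h1 : a < b) (h2 : c < d)
    (h : ({a, b} : Finset (Fin n)) = {c, d}) : a = c ∧ b = d := by
  have ha : a ∈ ({c, d} : Finset (Fin n)) := h ▸ (by simp)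
  have hb : b ∈ ({c, d} : Finset (Fin n)) := h ▸ (by simp)
  simp only [Finset.mem_insert, Finset.mem_singleton] at ha hb
  omega

lemma iso_pair_aux {n : ℕ} {a b : Fin n} (h : ({a, b} : Finset (Fin n)).card = 2) :
    ((({a, b} : Finset (Fin n)).orderIsoOfFin h 0 : Fin n) = a ∧
      (({a, b} : Finset (Fin n)).orderIsoOfFin h 1 : Fin n) = b) ∨
    ((({a, b} : Finset (Fin n)).orderIsoOfFin h 0 : Fin n) = b ∧
      (({a, b} : Finset (Fin n)).orderIsoOfFin h 1 : Fin n) = a) := by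
  have h0 := (({a, b} : Finset (Fin n)).orderIsoOfFin h 0).2
  have h1 := (({a, b} : Finset (Fin n)).orderIsoOfFin h 1).2
  have hne : (({a, b} : Finset (Fin n)).orderIsoOfFin h 0 : Fin n) ≠
      (({a, b} : Finset (Fin n)).orderIsoOfFin h 1 : Fin n) := by
    intro e
    have := (({a, b} : Finset (Fin n)).orderIsoOfFin h).injective (Subtype.ext e)
    simp at this
  simp only [Finset.mem_insert, Finset.mem_singleton] at h0 h1
  rcases h0 with h0 | h0 <;> rcases h1 with h1 | h1
  · exact absurd (h0.trans h1.symm) hne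
  · exact Or.inl ⟨h0, h1⟩
  · exact Or.inr ⟨h0, h1⟩
  · exact absurd (h0.trans h1.symm) hne

lemma card_good_le {n : ℕ} (A : Matrix (Fin n) (Fin n) ℝ) : (goodQuad A).card ≤ Z 2 A := by
  unfold Z
  have hg : ∀ q ∈ goodQuad A, q.1.1 < q.1.2 ∧ q.2.1 < q.2.2 ∧
      A q.1.1 q.2.1 * A q.1.2 q.2.2 = A q.1.1 q.2.2 * A q.1.2 q.2.1 := by
    intro q hq
    simpa [goodQuad] using hq
  rw [← Nat.card_eq_finsetCard]
  refine Nat.card_le_card_of_injective (fun q => ⟨(({q.1.1.1, q.1.1.2} : Finset (Fin n)),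
    ({q.1.2.1, q.1.2.2} : Finset (Fin n))), ?_⟩) ?_
  · obtain ⟨h1, h2, h3⟩ := hg q.1 q.2
    refine ⟨Finset.card_pair h1.ne, Finset.card_pair h2.ne, ?_⟩
    rw [Matrix.det_fin_two]
    simp only [Matrix.submatrix_apply]
    rcases iso_pair_aux (Finset.card_pair h1.ne) with ⟨e1, e2⟩ | ⟨e1, e2⟩ <;>
    rcases iso_pair_aux (Finset.card_pair h2.ne) with ⟨e3, e4⟩ | ⟨e3, e4⟩ <;>
    rw [e1, e2, e3, e4] <;> linarith
  · rintro ⟨⟨⟨a, b⟩, c, d⟩, hq⟩ ⟨⟨⟨a', b'⟩, c', d'⟩, hq'⟩ he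
    obtain ⟨h1, h2, -⟩ := hg _ hq
    obtain ⟨h1', h2', -⟩ := hg _ hq'
    simp only [Subtype.mk.injEq, Prod.mk.injEq] at he
    obtain ⟨e1, e2⟩ := pair_inj_aux h1 h1' he.1
    obtain ⟨e3, e4⟩ := pair_inj_aux h2 h2' he.2
    subst e1 e2 e3 e4
    rfl

/-- Any `{±1}`-matrix of order `n ≥ 2` has at least `n²(n-1)(n-2)/8` vanishing
minors of order `2`. -/
theorem count_vanishing_order_two_minors_lower_bound {n : ℕ} (hn : 2 ≤ n)
    (A : Matrix (Fin n) (Fin n) ℝ) (hA : IsPM1 A) :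
    (n : ℝ) ^ 2 * ((n : ℝ) - 1) * ((n : ℝ) - 2) / 8 ≤ (Z 2 A : ℝ) := by
  have h0 : ((goodQuad A).card : ℝ) ≤ Z 2 A := by exact_mod_cast card_good_le A
  refine le_trans ?_ h0
  have hc : ((goodQuad A).card : ℝ) = ∑ i, ∑ i', (if i < i' then
      ∑ j, ∑ j', (if j < j' then 1 + A i j * A i' j * (A i j' * A i' j') else 0) / 2 else 0) := by
    unfold goodQuad
    rw [Finset.card_filter]
    push_cast
    simp only [Fintype.sum_prod_type]
    refine Finset.sum_congr rfl fun i _ => Finset.sum_congr rfl fun i' _ => ?_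
    by_cases hi : i < i'
    · simp only [hi, true_and, if_true]
      refine Finset.sum_congr rfl fun j _ => Finset.sum_congr rfl fun j' _ => ?_
      by_cases hj : j < j'
      · simp only [hj, true_and, if_true]
        rcases hA i j with h1 | h1 <;> rcases hA i' j with h2 | h2 <;>
        rcases hA i j' with h3 | h3 <;> rcases hA i' j' with h4 | h4 <;>
        rw [h1, h2, h3, h4] <;> norm_num
      · simp [hj]
    · simp [hi]
  rw [hc]
  have hp := sym_sum_aux (n := n) (fun _ _ => (1 : ℝ)) (fun _ _ => rfl)
  have hle : ∑ i : Fin n, ∑ i' : Fin n, (if i < i' then (1 : ℝ) else 0) *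
      ((n : ℝ) * ((n : ℝ) - 2) / 4) ≤ ∑ i, ∑ i', (if i < i' then
      ∑ j, ∑ j', (if j < j' then 1 + A i j * A i' j * (A i j' * A i' j') else 0) / 2 else 0) := by
    refine Finset.sum_le_sum fun i _ => Finset.sum_le_sum fun i' _ => ?_
    by_cases hi : i < i'
    · simp only [hi, if_true, ← Finset.sum_div]
      have := row_pair_aux A hA i i'
      linarith
    · simp [hi]
  refine le_trans (le_of_eq ?_) hle
  simp only [← Finset.sum_mul]
  generalize (∑ i : Fin n, ∑ i' : Fin n, (if i < i' then (1 : ℝ) else 0)) = T at hp ⊢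
  simp at hp
  have : T = (n * n - n) / 2 := by linarith
  rw [this]; ring
end
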